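/- Let (W, S) be a Coxeter system and I ⊆ S. If w ∈ W satisfies w W_I w⁻¹ = W_I and w has minimal length in the coset w W_I, then conjugation by w maps the set I bijectively onto I (i.e. for every s ∈ I one has w s w⁻¹ ∈ I), and consequently ℓ(w u w⁻¹) = ℓ(u) for all u ∈ W_I. -/

import Mathlib

/-- The standard parabolic subgroup `W_I` of a Coxeter system, generated by the
simple reflections indexed by `I`. -/
def CoxeterSystem.parabolic {B W : Type*} [Group W] {M : CoxeterMatrix B}
    (cs : CoxeterSystem M W) (I : Set B) : Subgroup W :=
  Subgroup.closure (cs.simple '' I)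

/-- The set `𝒲_I` of all `w ∈ W` such that `w W_I w⁻¹ = W_I` and `w` has minimal
length in the coset `w W_I`. -/
def CoxeterSystem.minNormalizing {B W : Type*} [Group W] {M : CoxeterMatrix B}
    (cs : CoxeterSystem M W) (I : Set B) : Set W :=
  {w : W | (cs.parabolic I).map (MulAut.conj w).toMonoidHom = cs.parabolic I ∧
    ∀ u ∈ cs.parabolic I, cs.length w ≤ cs.length (w * u)}

namespace CoxeterSystem

variable {B W : Type*} [Group W] {M : CoxeterMatrix B} (cs : CoxeterSystem M W)

open Classical in
/-- The involution `(t, ε) ↦ (s t s, ε + [t = s])` of `W × ZMod 2` attached to a simple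
reflection `s`. -/
noncomputable def signedConjSimple (i : B) : Equiv.Perm (W × ZMod 2) :=
  Function.Involutive.toPerm
    (fun p => (cs.simple i * p.1 * cs.simple i, p.2 + if p.1 = cs.simple i then 1 else 0)) (by
      rintro ⟨t, e⟩
      have h : cs.simple i * t * cs.simple i = cs.simple i ↔ t = cs.simple i := by
        constructor
        · intro h
          have := congrArg (fun x => cs.simple i * x * cs.simple i) h
          simpa [mul_assoc] using this
        · rintro rfl
          simp
      ext
      · simp [mul_assoc]
      · simp only [h, add_assoc, CharTwo.add_self_eq_zero, add_zero])

open Classical in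
theorem signedConjSimple_apply (i : B) (t : W) (e : ZMod 2) :
    cs.signedConjSimple i (t, e) =
      (cs.simple i * t * cs.simple i, e + if t = cs.simple i then 1 else 0) := rfl

theorem simple_mul_pow_mul_simple (i j : B) (n : ℕ) :
    cs.simple j * (cs.simple i * cs.simple j) ^ n * cs.simple j =
      ((cs.simple i * cs.simple j) ^ n)⁻¹ := by
  have h := conj_pow (a := cs.simple j) (b := cs.simple i * cs.simple j) (i := n)
  rw [cs.inv_simple] at h
  rw [← h, ← inv_pow]
  congr 1
  simp [mul_assoc]

open Classical in
theorem signedConjSimple_mul_pow_apply (i j : B) (n : ℕ) (t : W) (e : ZMod 2) :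
    ((cs.signedConjSimple i * cs.signedConjSimple j) ^ n) (t, e) =
      ((cs.simple i * cs.simple j) ^ n * t * ((cs.simple i * cs.simple j) ^ n)⁻¹,
        e + ∑ k ∈ Finset.range (2 * n),
          if t = cs.simple j * (cs.simple i * cs.simple j) ^ k then 1 else 0) := by
  induction n with
  | zero => simp
  | succ n ih =>
    rw [pow_succ', Equiv.Perm.mul_apply, ih, Equiv.Perm.mul_apply, signedConjSimple_apply,
      signedConjSimple_apply]
    set c := cs.simple i * cs.simple j with hc
    have key : cs.simple j * c ^ n = (c ^ n)⁻¹ * cs.simple j := by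
      rw [← cs.simple_mul_pow_mul_simple i j n]
      simp [hc, mul_assoc]
    have h1 : c ^ n * t * (c ^ n)⁻¹ = cs.simple j ↔ t = cs.simple j * c ^ (2 * n) := by
      rw [two_mul, pow_add, ← mul_assoc, key, mul_inv_eq_iff_eq_mul, mul_assoc,
        ← eq_inv_mul_iff_mul_eq]
    have h2 : cs.simple j * (c ^ n * t * (c ^ n)⁻¹) * cs.simple j = cs.simple i ↔
        t = cs.simple j * c ^ (2 * n + 1) := by
      have h3 : cs.simple j * (c ^ n * t * (c ^ n)⁻¹) * cs.simple j = cs.simple i ↔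
          c ^ n * t * (c ^ n)⁻¹ = cs.simple j * c := by
        rw [← eq_mul_inv_iff_mul_eq, cs.inv_simple, ← hc, ← eq_inv_mul_iff_mul_eq,
          cs.inv_simple]
      have h4 : cs.simple j * c ^ (2 * n + 1) = (c ^ n)⁻¹ * (cs.simple j * c * c ^ n) := by
        rw [show 2 * n + 1 = n + (1 + n) by ring, pow_add, ← mul_assoc, key, pow_add, pow_one]
        simp only [mul_assoc]
      rw [h3, h4, mul_inv_eq_iff_eq_mul, ← eq_inv_mul_iff_mul_eq]
    ext
    · simp [hc, pow_succ', mul_assoc]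
    · simp only [h1, h2]
      rw [show 2 * (n + 1) = 2 * n + 1 + 1 by ring, Finset.sum_range_succ, Finset.sum_range_succ]
      simp only [add_assoc]

theorem isLiftable_signedConjSimple : M.IsLiftable cs.signedConjSimple := by
  classical
  intro i j
  ext1 ⟨t, e⟩
  rw [signedConjSimple_mul_pow_apply, cs.simple_mul_simple_pow i j, two_mul, Finset.sum_range_add]
  simp [pow_add, cs.simple_mul_simple_pow i j, CharTwo.add_self_eq_zero]

/-- The action of `W` on `W × ZMod 2` by conjugation on the first factor, whose second
component records parities of inversion multiplicities. -/
noncomputable def signedConj : W →* Equiv.Perm (W × ZMod 2) :=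
  cs.lift ⟨cs.signedConjSimple, cs.isLiftable_signedConjSimple⟩

theorem signedConj_simple (i : B) : cs.signedConj (cs.simple i) = cs.signedConjSimple i :=
  cs.lift_apply_simple cs.isLiftable_signedConjSimple i

open Classical in
theorem signedConj_wordProd_apply (ω : List B) (t : W) (e : ZMod 2) :
    cs.signedConj (cs.wordProd ω) (t, e) =
      (cs.wordProd ω * t * (cs.wordProd ω)⁻¹, e + ((cs.rightInvSeq ω).count t : ZMod 2)) := by
  induction ω with
  | nil => simp
  | cons i ω ih =>
    rw [cs.wordProd_cons, map_mul, Equiv.Perm.mul_apply, ih, signedConj_simple,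
      signedConjSimple_apply]
    have h : cs.wordProd ω * t * (cs.wordProd ω)⁻¹ = cs.simple i ↔
        (cs.wordProd ω)⁻¹ * cs.simple i * cs.wordProd ω = t := by
      rw [mul_inv_eq_iff_eq_mul, ← eq_inv_mul_iff_mul_eq, eq_comm, mul_assoc]
    ext
    · simp [mul_assoc]
    · simp only [h, rightInvSeq, List.count_cons, beq_iff_eq, Nat.cast_add, Nat.cast_ite,
        Nat.cast_one, Nat.cast_zero, add_assoc]

/-- The parity of the number of occurrences of `t` in the right inversion sequence of any
word for `w`. -/
noncomputable def inversionParity (w t : W) : ZMod 2 := (cs.signedConj w (t, 0)).2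

open Classical in
theorem inversionParity_wordProd (ω : List B) (t : W) :
    cs.inversionParity (cs.wordProd ω) t = ((cs.rightInvSeq ω).count t : ZMod 2) := by
  simp [inversionParity, signedConj_wordProd_apply]

theorem signedConj_apply (w t : W) (e : ZMod 2) :
    cs.signedConj w (t, e) = (w * t * w⁻¹, e + cs.inversionParity w t) := by
  classical
  obtain ⟨ω, rfl⟩ := cs.wordProd_surjective w
  rw [signedConj_wordProd_apply, inversionParity_wordProd]

theorem inversionParity_mul (w u t : W) :
    cs.inversionParity (w * u) t =
      cs.inversionParity u t + cs.inversionParity w (u * t * u⁻¹) := by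
  rw [inversionParity, map_mul, Equiv.Perm.mul_apply, signedConj_apply, signedConj_apply,
    zero_add]

theorem inversionParity_one (t : W) : cs.inversionParity 1 t = 0 := by
  simp [inversionParity]

theorem inversionParity_simple_self (i : B) :
    cs.inversionParity (cs.simple i) (cs.simple i) = 1 := by
  simp [inversionParity, signedConj_simple, signedConjSimple_apply]

theorem IsReflection.inversionParity_self {t : W} (ht : cs.IsReflection t) :
    cs.inversionParity t t = 1 := by
  obtain ⟨u, i, rfl⟩ := ht
  have h := cs.inversionParity_mul u u⁻¹ (u * cs.simple i * u⁻¹)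
  have h' := cs.inversionParity_mul (u * cs.simple i) u⁻¹ (u * cs.simple i * u⁻¹)
  have h'' := cs.inversionParity_mul u (cs.simple i) (cs.simple i)
  have hconj : u⁻¹ * (u * cs.simple i * u⁻¹) * u⁻¹⁻¹ = cs.simple i := by group
  rw [hconj] at h h'
  rw [mul_inv_cancel, inversionParity_one] at h
  rw [mul_inv_cancel_right, inversionParity_simple_self] at h''
  rw [h', h'', add_left_comm, ← h, add_zero]

theorem mem_rightInvSeq_of_inversionParity_eq_one {ω : List B} {t : W}
    (h : cs.inversionParity (cs.wordProd ω) t = 1) : t ∈ cs.rightInvSeq ω := by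
  classical
  by_contra hmem
  rw [inversionParity_wordProd, List.count_eq_zero_of_not_mem hmem] at h
  simp at h

theorem length_mul_lt_of_inversionParity_eq_one {w t : W} (h : cs.inversionParity w t = 1) :
    cs.length (w * t) < cs.length w := by
  obtain ⟨ω, hω, rfl⟩ := cs.exists_isReduced w
  exact (cs.isRightInversion_of_mem_rightInvSeq hω
    (cs.mem_rightInvSeq_of_inversionParity_eq_one h)).2

theorem IsReflection.inversionParity_eq_one_iff {t : W} (ht : cs.IsReflection t) (w : W) :
    cs.inversionParity w t = 1 ↔ cs.length (w * t) < cs.length w := by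
  refine ⟨cs.length_mul_lt_of_inversionParity_eq_one, fun hlt => ?_⟩
  by_contra hne
  have h0 : cs.inversionParity w t = 0 := by
    generalize cs.inversionParity w t = x at hne
    revert x
    decide
  have h := cs.length_mul_lt_of_inversionParity_eq_one (w := w * t) (t := t) (by
    rw [inversionParity_mul, ht.inversionParity_self, mul_inv_cancel_right, h0, add_zero])
  rw [mul_assoc, ht.mul_self, mul_one] at h
  exact absurd h hlt.asymm

/-- The strong exchange property. -/
theorem mem_rightInvSeq_of_isRightInversion {ω : List B} {t : W}
    (h : cs.IsRightInversion (cs.wordProd ω) t) : t ∈ cs.rightInvSeq ω :=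
  cs.mem_rightInvSeq_of_inversionParity_eq_one ((h.1.inversionParity_eq_one_iff cs _).2 h.2)

variable {cs} {I : Set B}

theorem simple_mem_parabolic {i : B} (hi : i ∈ I) : cs.simple i ∈ cs.parabolic I :=
  Subgroup.subset_closure ⟨i, hi, rfl⟩

theorem parabolic_induction {p : (u : W) → u ∈ cs.parabolic I → Prop}
    (one : p 1 (one_mem _))
    (mul_simple : ∀ (u : W) (hu : u ∈ cs.parabolic I) (i : B) (hi : i ∈ I), p u hu →
      p (u * cs.simple i) (mul_mem hu (simple_mem_parabolic hi)))
    {u : W} (hu : u ∈ cs.parabolic I) : p u hu := by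
  induction hu using Subgroup.closure_induction_right with
  | one => exact one
  | mul_right x hx y hy ih =>
    obtain ⟨i, hi, rfl⟩ := hy
    exact mul_simple x hx i hi ih
  | mul_inv_cancel x hx y hy ih =>
    obtain ⟨i, hi, rfl⟩ := hy
    simp only [cs.inv_simple]
    exact mul_simple x hx i hi ih

theorem exists_isReduced_of_mem_parabolic {u : W} (hu : u ∈ cs.parabolic I) :
    ∃ ω : List B, (∀ i ∈ ω, i ∈ I) ∧ cs.IsReduced ω ∧ u = cs.wordProd ω := by
  induction hu using parabolic_induction with
  | one => exact ⟨[], by simp, by simp [IsReduced], by simp⟩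
  | mul_simple u _ i hi ih =>
    obtain ⟨ω, hωI, hω, rfl⟩ := ih
    rcases cs.length_mul_simple (cs.wordProd ω) i with h | h
    · refine ⟨ω ++ [i], ?_, ?_, ?_⟩
      · simpa [or_imp, forall_and] using ⟨hωI, hi⟩
      · simp [IsReduced, cs.wordProd_append, h, hω.eq]
      · simp [cs.wordProd_append]
    · have hmem := cs.mem_rightInvSeq_of_isRightInversion
        (ω := ω) ⟨cs.isReflection_simple i, by omega⟩
      obtain ⟨k, hk, hki⟩ := List.getElem_of_mem hmem
      have hprod := cs.wordProd_mul_getD_rightInvSeq ω k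
      rw [List.getD_eq_getElem _ _ hk, hki] at hprod
      rw [length_rightInvSeq] at hk
      refine ⟨ω.eraseIdx k, fun i hi => hωI i (List.mem_of_mem_eraseIdx hi), ?_, hprod⟩
      rw [IsReduced, ← hprod, List.length_eraseIdx_of_lt hk]
      have := hω.eq
      omega

theorem exists_mem_eq_simple_of_mem_parabolic {u : W} (hu : u ∈ cs.parabolic I)
    (hlen : cs.length u = 1) : ∃ i ∈ I, u = cs.simple i := by
  obtain ⟨ω, hωI, hω, rfl⟩ := exists_isReduced_of_mem_parabolic hu
  rw [hω.eq, List.length_eq_one_iff] at hlen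
  obtain ⟨i, rfl⟩ := hlen
  exact ⟨i, hωI i (by simp), by simp⟩

/-- Lengths add for a minimal-length representative of a coset of a standard parabolic. -/
theorem length_mul_of_mem_parabolic {w : W}
    (hw : ∀ u ∈ cs.parabolic I, cs.length w ≤ cs.length (w * u))
    {u : W} (hu : u ∈ cs.parabolic I) :
    cs.length (w * u) = cs.length w + cs.length u := by
  induction hu using parabolic_induction with
  | one => simp
  | mul_simple u hu i hi ih =>
    have hmem : u * cs.simple i * u⁻¹ ∈ cs.parabolic I :=
      mul_mem (mul_mem hu (simple_mem_parabolic hi)) (inv_mem hu)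
    have h0 : cs.inversionParity w (u * cs.simple i * u⁻¹) = 0 := by
      have hne : cs.inversionParity w (u * cs.simple i * u⁻¹) ≠ 1 := fun h =>
        (cs.length_mul_lt_of_inversionParity_eq_one h).not_ge (hw _ hmem)
      generalize cs.inversionParity w (u * cs.simple i * u⁻¹) = x at hne
      revert x
      decide
    have hpar := cs.inversionParity_mul w u (cs.simple i)
    rw [h0, add_zero] at hpar
    have h1 := (cs.isReflection_simple i).inversionParity_eq_one_iff cs (w * u)
    rw [hpar, (cs.isReflection_simple i).inversionParity_eq_one_iff cs u] at h1
    rw [← mul_assoc]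
    have h2 := cs.length_mul_simple (w * u) i
    have h3 := cs.length_mul_simple u i
    omega

theorem conj_mem_parabolic_iff {w : W} (hw : w ∈ cs.minNormalizing I) (u : W) :
    w * u * w⁻¹ ∈ cs.parabolic I ↔ u ∈ cs.parabolic I := by
  conv_lhs => rw [← hw.1]
  simp [Subgroup.mem_map]

theorem inv_minimal_of_mem_minNormalizing {w : W} (hw : w ∈ cs.minNormalizing I) :
    ∀ u ∈ cs.parabolic I, cs.length w⁻¹ ≤ cs.length (w⁻¹ * u) := by
  intro u hu
  have hmem : w⁻¹ * u⁻¹ * w ∈ cs.parabolic I := by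
    rw [← conj_mem_parabolic_iff hw]
    simpa [mul_assoc] using hu
  have h := hw.2 _ hmem
  rw [← cs.length_inv (w⁻¹ * u), cs.length_inv w]
  simpa [mul_assoc] using h

theorem length_conj_of_mem_minNormalizing {w : W} (hw : w ∈ cs.minNormalizing I)
    {u : W} (hu : u ∈ cs.parabolic I) : cs.length (w * u * w⁻¹) = cs.length u := by
  have h1 := length_mul_of_mem_parabolic hw.2 hu
  have h2 := length_mul_of_mem_parabolic (inv_minimal_of_mem_minNormalizing hw)
    (inv_mem ((conj_mem_parabolic_iff hw u).2 hu))
  rw [← mul_inv_rev, cs.length_inv, cs.length_inv, cs.length_inv, inv_mul_cancel_right] at h2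
  omega

end CoxeterSystem

/-- If `w W_I w⁻¹ = W_I` and `w` has minimal length in `w W_I`, then
conjugation by `w` maps `I` into `I` (hence bijectively onto `I`), and consequently
`ℓ(w u w⁻¹) = ℓ(u)` for all `u ∈ W_I`. -/
theorem conj_of_minNormalizing {B W : Type*} [Group W] {M : CoxeterMatrix B}
    (cs : CoxeterSystem M W) (I : Set B) (w : W)
    (hw : w ∈ cs.minNormalizing I) :
    (∀ i ∈ I, ∃ j ∈ I, w * cs.simple i * w⁻¹ = cs.simple j) ∧
    (∀ u ∈ cs.parabolic I, cs.length (w * u * w⁻¹) = cs.length u) := by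
  refine ⟨fun i hi => ?_, fun u hu => CoxeterSystem.length_conj_of_mem_minNormalizing hw hu⟩
  have hmem := CoxeterSystem.simple_mem_parabolic (cs := cs) hi
  exact CoxeterSystem.exists_mem_eq_simple_of_mem_parabolic
    ((CoxeterSystem.conj_mem_parabolic_iff hw _).2 hmem)
    ((CoxeterSystem.length_conj_of_mem_minNormalizing hw hmem).trans (cs.length_simple i))
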